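/- Let δ > 0 and k ∈ ℕ. If S ⊆ ℤ is finite and δ-nonrecurrent, then there exist η > 0, d > k, and an independent α ∈ 𝕋^d such that S + BH(α; k, η) is δ-nonrecurrent. -/

import Mathlib

open Filter Pointwise

/-- Upper Banach density of a set of integers:
`d*(A) = limsup_{n→∞} sup_{k∈ℤ} |A ∩ {k+1,…,k+n}| / n`. -/
noncomputable def upperBanachDensity (A : Set ℤ) : ℝ :=
  Filter.atTop.limsup fun n : ℕ =>
    ⨆ k : ℤ, (Nat.card ↥(A ∩ Set.Ioc k (k + n)) : ℝ) / n

/-- A set `S ⊆ ℤ` is `δ`-nonrecurrent if there is `A ⊆ ℤ` with upper Banach density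
`d*(A) > δ` such that `(A - A) ∩ S = ∅`. -/
def Nonrecurrent (δ : ℝ) (S : Set ℤ) : Prop :=
  ∃ A : Set ℤ, δ < upperBanachDensity A ∧ (A - A) ∩ S = ∅

/-- The Bohr–Hamming ball `BH(α; k, ε)`: the set of `n ∈ ℤ` such that at most `k`
coordinates of `nα` differ from `0` by at least `ε`. -/
noncomputable def bohrHamming {d : ℕ} (α : Fin d → AddCircle (1 : ℝ)) (k : ℕ) (ε : ℝ) :
    Set ℤ :=
  {n : ℤ | Set.ncard {j : Fin d | ε ≤ ‖(n • α) j‖} ≤ k}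


def cw {C : Type*} [DecidableEq C] (a b c : C) : ℤ := (if c = a then 1 else 0) - (if c = b then 1 else 0)

def cW {C : Type*} [DecidableEq C] (a b : C) {d : ℕ} (x : Fin d → C) : ℤ := ∑ j, cw a b (x j)

def cB {C : Type*} [Fintype C] [DecidableEq C] (a b : C) (t : ℤ) (d : ℕ) : ℤ :=
  ∑ x : Fin d → C, if cW a b x = t then 1 else 0
def cT {C : Type*} [Fintype C] [DecidableEq C] (a b : C) (t : ℤ) (d : ℕ) : ℤ :=
  ∑ x : Fin d → C, |cW a b x - t|
def cS {C : Type*} [Fintype C] [DecidableEq C] (a b : C) (t : ℤ) (d : ℕ) : ℤ :=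
  ∑ x : Fin d → C, (cW a b x - t)^2

theorem sum_succ_fun {C : Type*} [Fintype C] [DecidableEq C] (a b : C) (d : ℕ) (f : ℤ → ℤ) :
    ∑ x : Fin (d+1) → C, f (cW a b x) = ∑ x : Fin d → C, ∑ c : C, f (cW a b x + cw a b c) := by
  rw [← (Fin.consEquiv (fun _ : Fin (d+1) => C)).sum_comp, Fintype.sum_prod_type, Finset.sum_comm]
  refine Finset.sum_congr rfl fun x _ => Finset.sum_congr rfl fun c _ => ?_
  simp [cW, Fin.consEquiv, Fin.sum_univ_succ, add_comm]

theorem sum_c {C : Type*} [Fintype C] [DecidableEq C] (a b : C) (hab : a ≠ b) (f : ℤ → ℤ) (w : ℤ) :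
    ∑ c : C, f (w + cw a b c) = Fintype.card C * f w + (f (w+1) + f (w-1) - 2 * f w) := by
  have : ∀ c, f (w + cw a b c) = f w + ((if c = a then f (w+1) - f w else 0) +
      (if c = b then f (w-1) - f w else 0)) := by
    intro c
    unfold cw
    by_cases h1 : c = a
    · subst h1; simp [hab]
    · by_cases h2 : c = b
      · subst h2; simp [h1, sub_eq_add_neg]
      · simp [h1, h2]
  simp_rw [this, Finset.sum_add_distrib]
  simp
  ring

theorem cT_succ {C : Type*} [Fintype C] [DecidableEq C] (a b : C) (hab : a ≠ b) (t : ℤ) (d : ℕ) :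
    cT a b t (d+1) = Fintype.card C * cT a b t d + 2 * cB a b t d := by
  unfold cT cB
  rw [sum_succ_fun a b d (fun w => |w - t|)]
  simp_rw [sum_c a b hab (fun w => |w - t|), Finset.sum_add_distrib, Finset.mul_sum]
  congr 1
  refine Finset.sum_congr rfl fun x _ => ?_
  generalize cW a b x = w
  split_ifs with h
  · subst h; simp
  · rcases lt_or_gt_of_ne h with h | h
    · rw [abs_of_nonpos, abs_of_nonpos, abs_of_nonpos] <;> omega
    · rw [abs_of_nonneg, abs_of_nonneg, abs_of_nonneg] <;> omega

theorem cS_succ {C : Type*} [Fintype C] [DecidableEq C] (a b : C) (hab : a ≠ b) (t : ℤ) (d : ℕ) :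
    cS a b t (d+1) = Fintype.card C * cS a b t d + 2 * (Fintype.card C)^d := by
  unfold cS
  rw [sum_succ_fun a b d (fun w => (w - t)^2)]
  simp_rw [sum_c a b hab (fun w => (w - t)^2), Finset.sum_add_distrib, Finset.mul_sum]
  congr 1
  rw [Finset.sum_congr rfl (g := fun _ => 2)]
  · simp [mul_comm]
  · intro x _; ring

theorem cS_eq {C : Type*} [Fintype C] [DecidableEq C] (a b : C) (hab : a ≠ b) (t : ℤ) (d : ℕ) :
    Fintype.card C * cS a b t d = (Fintype.card C)^d * (Fintype.card C * t^2 + 2 * d) := by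
  induction d with
  | zero => simp [cS, cW]
  | succ d ih => rw [cS_succ a b hab, mul_add, ih]; push_cast; ring

theorem sumB {C : Type*} [Fintype C] [DecidableEq C] (a b : C) (hab : a ≠ b) (t : ℤ) (D : ℕ) :
    ∑ d ∈ Finset.range D, 2 * (cB a b t d : ℝ) / (Fintype.card C : ℝ)^(d+1)
      ≤ (cT a b t D : ℝ) / (Fintype.card C : ℝ)^D := by
  have hC : (0:ℝ) < Fintype.card C := by
    have := Fintype.card_pos_iff.2 ⟨a⟩
    exact_mod_cast this
  induction D with
  | zero => simp [cT]
  | succ D ih =>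
    rw [Finset.sum_range_succ, cT_succ a b hab]
    push_cast
    rw [add_div]
    gcongr
    refine ih.trans (le_of_eq ?_)
    field_simp
    ring

theorem sumB' {C : Type*} [Fintype C] [DecidableEq C] (a b : C) (hab : a ≠ b) (t : ℤ) (D : ℕ)
    (l : ℝ) (hl : 0 < l) :
    ∑ d ∈ Finset.range D, (cB a b t d : ℝ) / (Fintype.card C : ℝ)^d
      ≤ (Fintype.card C : ℝ) * ((t^2 + D) / l + l) := by
  have hC0 := Fintype.card_pos_iff.2 ⟨a⟩
  have hC : (1:ℝ) ≤ Fintype.card C := by exact_mod_cast hC0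
  have h1 := sumB a b hab t D
  have h2 : 2 * l * (cT a b t D : ℝ) ≤ cS a b t D + l^2 * (Fintype.card C : ℝ)^D := by
    have : l^2 * (Fintype.card C : ℝ)^D = ∑ x : Fin D → C, l^2 := by simp [mul_comm]
    rw [this]
    unfold cS cT
    push_cast
    rw [Finset.mul_sum, ← Finset.sum_add_distrib]
    refine Finset.sum_le_sum fun x _ => ?_
    have := sq_nonneg (|(cW a b x - t : ℝ)| - l)
    have h := sq_abs ((cW a b x - t : ℝ))
    nlinarith
  have h3 : (Fintype.card C : ℝ) * (cS a b t D) = (Fintype.card C : ℝ)^D * (Fintype.card C * t^2 + 2 * D) := by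
    exact_mod_cast cS_eq a b hab t D
  set N : ℝ := ((Fintype.card C : ℕ) : ℝ)
  have hN : 0 < N := by linarith
  have e : ∑ d ∈ Finset.range D, 2 * (cB a b t d : ℝ) / N^(d+1) = (2 / N) * ∑ d ∈ Finset.range D, (cB a b t d : ℝ) / N^d := by
    rw [Finset.mul_sum]
    refine Finset.sum_congr rfl fun d _ => ?_
    field_simp
    ring
  rw [e] at h1
  have h4 : (cS a b t D : ℝ) = N^D * (t^2 + 2 * D / N) := by
    field_simp; linarith
  have h5 : (cT a b t D : ℝ) / N^D ≤ (t^2 + 2 * D / N + l^2) / (2 * l) := by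
    rw [div_le_div_iff₀ (by positivity) (by positivity)]
    rw [h4] at h2; nlinarith
  have h6 := h1.trans h5
  have h7 : (t^2 + 2 * D / N + l^2) / (2 * l) ≤ 2 * ((t^2 + D) / l + l) := by
    have : 2 * (D:ℝ) / N ≤ 2 * D := div_le_self (by positivity) hC
    have e2 : 2 * ((t^2 + D) / l + l) = (4 * (t^2 + D) + 4 * l^2)/(2*l) := by field_simp; ring
    rw [e2]
    refine div_le_div_of_nonneg_right ?_ (by positivity)
    nlinarith [sq_nonneg (t:ℝ), sq_nonneg l, (Nat.cast_nonneg D : (0:ℝ) ≤ D)]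
  have h8 := h6.trans h7
  have h9 : ∑ d ∈ Finset.range D, (cB a b t d : ℝ) / N^d = N/2 * (2 / N * ∑ d ∈ Finset.range D, (cB a b t d : ℝ) / N^d) := by
    field_simp
  rw [h9]
  calc _ ≤ N/2 * (2 * ((t^2 + D) / l + l)) := by gcongr
    _ = _ := by ring

/-- index set of bad events -/
theorem exists_d {C : Type*} [Fintype C] [DecidableEq C] (k : ℕ) (ε : ℝ) (hε : 0 < ε) :
    ∃ d, k < d ∧ ∑ i ∈ (Finset.univ.filter (fun p : C × C => p.1 ≠ p.2)) ×ˢ Finset.Icc (-(2*k:ℤ)) (2*k),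
      (cB i.1.1 i.1.2 i.2 d : ℝ) / (Fintype.card C : ℝ)^d ≤ ε := by
  by_contra! hcon
  set I := (Finset.univ.filter (fun p : C × C => p.1 ≠ p.2)) ×ˢ Finset.Icc (-(2*k:ℤ)) (2*k) with hI
  set N : ℝ := ((Fintype.card C : ℕ) : ℝ)
  have hN : 0 ≤ N := by positivity
  set Q : ℝ := I.card * N
  have hQ : 0 ≤ Q := by positivity
  have key : ∀ D : ℕ, ∀ l : ℝ, 0 < l → (D - (k+1) : ℝ) * ε ≤ Q * (((2*k)^2 + D) / l + l) := by
    intro D l hl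
    have h1 : ∑ d ∈ Finset.range D, ∑ i ∈ I, (cB i.1.1 i.1.2 i.2 d : ℝ) / N^d ≤ Q * (((2*k)^2 + D) / l + l) := by
      rw [Finset.sum_comm]
      calc _ ≤ ∑ i ∈ I, N * (((2*k)^2 + D) / l + l) := by
            refine Finset.sum_le_sum fun i hi => ?_
            simp only [hI, Finset.mem_product, Finset.mem_filter, Finset.mem_univ, true_and, Finset.mem_Icc] at hi
            refine (sumB' _ _ hi.1 i.2 D l hl).trans ?_
            have : (i.2:ℝ)^2 ≤ (2*k)^2 := by
              have h1 : -(2*k:ℝ) ≤ i.2 := by exact_mod_cast hi.2.1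
              have h2 : (i.2:ℝ) ≤ 2*k := by exact_mod_cast hi.2.2
              nlinarith
            gcongr
        _ = _ := by simp [Q]; ring
    refine le_trans ?_ h1
    have h0 : ∀ d, 0 ≤ ∑ i ∈ I, (cB i.1.1 i.1.2 i.2 d : ℝ) / N^d := by
      intro d
      refine Finset.sum_nonneg fun i _ => div_nonneg ?_ (by positivity)
      have : 0 ≤ cB i.1.1 i.1.2 i.2 d := Finset.sum_nonneg fun x _ => by split_ifs <;> simp
      exact_mod_cast this
    calc (D - (k+1) : ℝ) * ε ≤ ((Finset.Ico (k+1) D).card : ℝ) * ε := by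
            gcongr
            simp only [Nat.card_Ico]
            have : D ≤ (D - (k+1)) + (k+1) := by omega
            have h : (D:ℝ) ≤ ((D - (k+1) : ℕ):ℝ) + (k+1) := by exact_mod_cast this
            linarith
      _ = ∑ d ∈ Finset.Ico (k+1) D, ε := by simp
      _ ≤ ∑ d ∈ Finset.Ico (k+1) D, ∑ i ∈ I, (cB i.1.1 i.1.2 i.2 d : ℝ) / N^d := by
            refine Finset.sum_le_sum fun d hd => (hcon d ?_).le
            simp at hd; omega
      _ ≤ _ := by
            refine Finset.sum_le_sum_of_subset_of_nonneg ?_ fun d _ _ => h0 d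
            intro d hd; simp at hd ⊢; omega
  set l : ℝ := 2 * (Q + 1) / ε with hl
  have hlp : 0 < l := by positivity
  obtain ⟨D, hD⟩ := exists_nat_gt ((2/ε) * ((k+1)*ε + Q * ((2*k)^2/l + l)))
  have := key D l hlp
  have e : Q * (((2*k:ℝ)^2 + D) / l + l) = Q * ((2*k)^2/l + l) + (Q/l) * D := by field_simp; ring
  rw [e] at this
  have h2 : Q / l ≤ ε / 2 := by
    rw [hl, div_div_eq_mul_div, div_le_div_iff₀ (by positivity) (by positivity)]
    nlinarith
  have h3 : Q / l * D ≤ ε/2 * D := by gcongr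
  have h4 : ((k+1)*ε + Q * ((2*k)^2/l + l)) < ε/2 * D := by
    have := mul_lt_mul_of_pos_left hD (show 0 < ε/2 by positivity)
    rw [← mul_assoc] at this
    rw [show ε/2*(2/ε) = 1 by field_simp, one_mul] at this
    exact this
  nlinarith

def cnt {C : Type*} [DecidableEq C] {d : ℕ} (x : Fin d → C) (a : C) : ℕ :=
  (Finset.univ.filter (fun j => x j = a)).card

theorem cW_eq {C : Type*} [DecidableEq C] {d : ℕ} (x : Fin d → C) (a b : C) :
    cW a b x = cnt x a - cnt x b := by
  simp [cW, cw, cnt, Finset.sum_sub_distrib]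

def G0 {C : Type*} [Fintype C] [DecidableEq C] (k d : ℕ) (a : C) : Finset (Fin d → C) :=
  Finset.univ.filter (fun x => ∀ b, b ≠ a → cnt x b + 2 * k < cnt x a)

theorem G0_disj {C : Type*} [Fintype C] [DecidableEq C] (k d : ℕ) (a b : C) (hab : a ≠ b) :
    Disjoint (G0 k d a) (G0 k d b) := by
  rw [Finset.disjoint_left]
  intro x hx hy
  simp only [G0, Finset.mem_filter, Finset.mem_univ, true_and] at hx hy
  have h1 := hx b hab.symm
  have h2 := hy a hab
  omega

theorem cnt_add {N : ℕ} {d : ℕ} (x : Fin d → ZMod N) (s a : ZMod N) :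
    cnt (fun j => x j + s) (a + s) = cnt x a := by
  simp [cnt]

theorem G0_card {N : ℕ} [NeZero N] (k d : ℕ) (a : ZMod N) :
    (G0 k d a).card = (G0 k d (0 : ZMod N)).card := by
  symm
  apply Finset.card_bij' (fun x _ => fun j => x j + a) (fun x _ => fun j => x j + (-a))
  · intro x hx
    simp only [G0, Finset.mem_filter, Finset.mem_univ, true_and] at hx ⊢
    intro b hb
    have h1 := hx (b - a) (by rwa [sub_ne_zero])
    have e1 := cnt_add x a (b - a)
    have e2 := cnt_add x a 0
    rw [sub_add_cancel] at e1
    rw [zero_add] at e2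
    omega
  · intro x hx
    simp only [G0, Finset.mem_filter, Finset.mem_univ, true_and] at hx ⊢
    intro b hb
    have h1 := hx (b + a) (by simpa using hb)
    have e1 := cnt_add x (-a) (b + a)
    have e2 := cnt_add x (-a) a
    rw [add_neg_cancel_right] at e1
    rw [add_neg_cancel] at e2
    omega
  · intro x _; simp
  · intro x _; simp

theorem G0_cover {C : Type*} [Fintype C] [DecidableEq C] [Nonempty C] (k d : ℕ) :
    ((Fintype.card C : ℕ) : ℤ)^d ≤ ∑ a : C, ((G0 k d a).card : ℤ) +
      ∑ i ∈ (Finset.univ.filter (fun p : C × C => p.1 ≠ p.2)) ×ˢ Finset.Icc (-(2*k:ℤ)) (2*k),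
        cB i.1.1 i.1.2 i.2 d := by
  have e : ∀ a : C, ((G0 k d a).card : ℤ) = ∑ x : Fin d → C, if x ∈ G0 k d a then 1 else 0 := by
    intro a; simp
  simp_rw [e]
  unfold cB
  rw [Finset.sum_comm, Finset.sum_comm (s := (Finset.univ.filter (fun p : C × C => p.1 ≠ p.2)) ×ˢ Finset.Icc (-(2*k:ℤ)) (2*k)), ← Finset.sum_add_distrib]
  have : ((Fintype.card C : ℕ) : ℤ)^d = ∑ x : Fin d → C, 1 := by simp
  rw [this]
  refine Finset.sum_le_sum fun x _ => ?_
  obtain ⟨a, ha⟩ := Finite.exists_max (fun a => cnt x a)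
  by_cases hx : x ∈ G0 k d a
  · refine le_add_of_le_of_nonneg ?_ (Finset.sum_nonneg fun _ _ => by split_ifs <;> simp)
    refine le_trans ?_ (Finset.single_le_sum (fun _ _ => by split_ifs <;> simp) (Finset.mem_univ a))
    simp [hx]
  · refine le_add_of_nonneg_of_le (Finset.sum_nonneg fun _ _ => by split_ifs <;> simp) ?_
    simp only [G0, Finset.mem_filter, Finset.mem_univ, true_and, not_forall, not_lt] at hx
    obtain ⟨b, hb, hle⟩ := hx
    have hm : ((a, b), cW a b x) ∈ (Finset.univ.filter (fun p : C × C => p.1 ≠ p.2)) ×ˢ Finset.Icc (-(2*k:ℤ)) (2*k) := by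
      have := ha b
      rw [cW_eq]
      simp only [Finset.mem_product, Finset.mem_filter, Finset.mem_univ, true_and, Finset.mem_Icc]
      refine ⟨hb.symm, ?_, ?_⟩ <;> omega
    refine le_trans ?_ (Finset.single_le_sum (fun _ _ => by split_ifs <;> simp) hm)
    simp

def GA {N : ℕ} [NeZero N] (A : Finset (ZMod N)) (k d : ℕ) : Finset (Fin d → ZMod N) :=
  A.biUnion (fun a => G0 k d a)

theorem GA_card {N : ℕ} [NeZero N] (A : Finset (ZMod N)) (k : ℕ) (δ : ℝ) (hδ : 0 < δ)
    (hA : δ * N < A.card) : ∃ d, k < d ∧ δ * (N:ℝ)^d < (GA A k d).card := by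
  have hN : (0:ℝ) < N := by exact_mod_cast Nat.pos_of_ne_zero (NeZero.ne N)
  have hAp : (0:ℝ) < A.card := lt_trans (by positivity) hA
  obtain ⟨d, hd, h⟩ := exists_d (C := ZMod N) k ((A.card - δ * N) / (2 * A.card))
    (div_pos (by linarith) (by positivity))
  refine ⟨d, hd, ?_⟩
  have h1 := G0_cover (C := ZMod N) k d
  simp_rw [G0_card] at h1
  have h2 : (GA A k d).card = A.card * (G0 k d (0 : ZMod N)).card := by
    unfold GA
    rw [Finset.card_biUnion (fun a _ b _ hab => G0_disj k d a b hab)]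
    simp_rw [G0_card]
    simp
  rw [← Finset.sum_div, div_le_iff₀ (by simp; positivity)] at h
  have h1' : ((ZMod N |> Fintype.card : ℕ) : ℝ)^d ≤ N * (G0 k d (0 : ZMod N)).card +
      ∑ i ∈ (Finset.univ.filter (fun p : ZMod N × ZMod N => p.1 ≠ p.2)) ×ˢ Finset.Icc (-(2*k:ℤ)) (2*k),
        (cB i.1.1 i.1.2 i.2 d : ℝ) := by
    simp only [Finset.sum_const, Finset.card_univ, ZMod.card, nsmul_eq_mul] at h1 ⊢
    exact_mod_cast h1
  rw [ZMod.card] at h h1'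
  rw [h2]
  push_cast
  set g : ℝ := ((G0 k d (0 : ZMod N)).card : ℝ)
  set a : ℝ := ((A.card : ℕ) : ℝ)
  have hP : (0:ℝ) < (N:ℝ)^d := by positivity
  have h3 := h1'.trans (add_le_add_right h (N * g))
  have h4 : a * (N:ℝ)^d ≤ N * (a * g) + (a - δ * N)/2 * (N:ℝ)^d := by
    calc a * (N:ℝ)^d ≤ a * (N * g + (a - δ * N) / (2 * a) * (N:ℝ)^d) := by gcongr
      _ = _ := by field_simp
  have h5 : 0 < (a - δ * N) * (N:ℝ)^d := mul_pos (by linarith) hP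
  have h6 : N * (δ * (N:ℝ)^d) < N * (a * g) := by nlinarith
  exact lt_of_mul_lt_mul_left h6 hN.le

theorem cnt_le {C : Type*} [DecidableEq C] {d : ℕ} (x y : Fin d → C) (a : C) (k : ℕ)
    (h : (Finset.univ.filter (fun j => x j ≠ y j)).card ≤ k) : cnt x a ≤ cnt y a + k := by
  refine le_trans ?_ (add_le_add_right h _)
  unfold cnt
  refine le_trans (Finset.card_le_card ?_) (Finset.card_union_le _ _)
  intro j hj
  simp only [Finset.mem_filter, Finset.mem_univ, true_and, Finset.mem_union] at hj ⊢
  by_cases hxy : x j = y j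
  · left; rw [← hxy]; exact hj
  · right; exact hxy

theorem GA_diff {N : ℕ} [NeZero N] (A : Finset (ZMod N)) (k d : ℕ) (s : ZMod N)
    (x y : Fin d → ZMod N) (hx : x ∈ GA A k d) (hy : y ∈ GA A k d)
    (h : (Finset.univ.filter (fun j => y j ≠ x j + s)).card ≤ k) :
    ∃ a ∈ A, ∃ b ∈ A, b = a + s := by
  simp only [GA, Finset.mem_biUnion, G0, Finset.mem_filter, Finset.mem_univ, true_and] at hx hy
  obtain ⟨a, ha, hxa⟩ := hx
  obtain ⟨b, hb, hyb⟩ := hy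
  refine ⟨a, ha, b, hb, ?_⟩
  by_contra hne
  have h1 := hyb (a + s) (fun h => hne h.symm)
  have h2 := hxa (b - s) (fun h => hne (by rw [← h]; simp))
  have h3 := cnt_le y (fun j => x j + s) b k h
  have h4 := cnt_le (fun j => x j + s) y (a + s) k (by simpa only [ne_comm] using h)
  have e1 := cnt_add x s (b - s)
  rw [sub_add_cancel] at e1
  have e2 := cnt_add x s a
  omega

theorem exists_indep (d : ℕ) (x : Fin d → AddCircle (1:ℝ)) (ε : ℝ) (hε : 0 < ε) :
    ∃ α : Fin d → AddCircle (1:ℝ), Dense (Set.range fun n : ℤ => n • α) ∧ ∀ j, ‖α j - x j‖ < ε := by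
  let b := TopologicalSpace.countableBasis (Fin d → AddCircle (1:ℝ))
  have hb := TopologicalSpace.isBasis_countableBasis (Fin d → AddCircle (1:ℝ))
  have key : Dense (⋂ o ∈ {o ∈ b | o.Nonempty}, {α : Fin d → AddCircle (1:ℝ) | ∃ n : ℤ, n • α ∈ o}) := by
    apply dense_biInter_of_isOpen
    · intro o ho
      have : {α : Fin d → AddCircle (1:ℝ) | ∃ n : ℤ, n • α ∈ o} = ⋃ n : ℤ, (fun α => n • α) ⁻¹' o := by
        ext; simp
      rw [this]
      exact isOpen_iUnion fun n => (hb.isOpen ho.1).preimage (continuous_const_smul n)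
    · exact (TopologicalSpace.countable_countableBasis _).mono fun o ho => ho.1
    · rintro o ⟨ho, y, hy⟩
      rw [Metric.dense_iff]
      intro α0 r hr
      obtain ⟨n, hn⟩ := exists_nat_one_div_lt hr
      have hn0 : (0:ℝ) < (n:ℝ) + 1 := by positivity
      have : ∀ j, ∃ t : ℝ, (0 ≤ t ∧ t < 1) ∧ (t : AddCircle (1:ℝ)) = y j - ((n:ℤ) + 1) • α0 j := by
        intro j
        obtain ⟨u, hu⟩ := QuotientAddGroup.mk_surjective (y j - ((n:ℤ) + 1) • α0 j)
        refine ⟨Int.fract u, ⟨Int.fract_nonneg u, Int.fract_lt_one u⟩, ?_⟩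
        rw [← hu, ← Int.self_sub_floor]
        have : ((⌊u⌋ : ℝ) : AddCircle (1:ℝ)) = 0 := by
          rw [AddCircle.coe_eq_zero_iff]; exact ⟨⌊u⌋, by simp⟩
        rw [AddCircle.coe_sub, this, sub_zero]
      choose t ht1 ht2 using this
      refine ⟨fun j => α0 j + ((t j / (n+1) : ℝ) : AddCircle (1:ℝ)), ?_, (n:ℤ)+1, ?_⟩
      · rw [Metric.mem_ball, dist_pi_lt_iff hr]
        intro j
        rw [dist_eq_norm, add_sub_cancel_left]
        refine lt_of_le_of_lt ?_ hn
        have h1 : ‖((t j / (n+1) : ℝ) : AddCircle (1:ℝ))‖ ≤ ‖t j / (n+1)‖ := by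
          rw [AddCircle.norm_eq]
          simpa [abs_div] using round_le (t j / (n+1) : ℝ) 0
        refine h1.trans ?_
        rw [Real.norm_of_nonneg (div_nonneg (ht1 j).1 hn0.le)]
        gcongr
        exact (ht1 j).2.le
      · convert hy using 1
        ext j
        simp only [Pi.smul_apply, smul_add]
        rw [← AddCircle.coe_zsmul]
        have : ((n:ℤ)+1) • (t j / (n+1) : ℝ) = t j := by
          rw [zsmul_eq_mul]; push_cast; field_simp
        rw [this, ht2]; abel
  obtain ⟨α, hα1, hα2⟩ := (Metric.dense_iff.1 key) x ε hε
  refine ⟨α, ?_, ?_⟩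
  · rw [hb.dense_iff]
    intro o ho hne
    simp only [Set.mem_iInter] at hα2
    obtain ⟨n, hn⟩ := hα2 o ⟨ho, hne⟩
    exact ⟨n • α, hn, n, rfl⟩
  · intro j
    rw [← dist_eq_norm]
    exact (dist_le_pi_dist α x j).trans_lt hα1

theorem card_nonneg_le (A : Set ℤ) (k : ℤ) (n : ℕ) :
    (Nat.card ↥(A ∩ Set.Ioc k (k + n)) : ℝ) / n ≤ 1 := by
  refine div_le_one_of_le₀ ?_ (by positivity)
  have : Nat.card ↥(A ∩ Set.Ioc k (k + n)) ≤ Nat.card ↥(Set.Ioc k (k + n)) :=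
    Nat.card_mono (Set.finite_Ioc _ _) Set.inter_subset_right
  have h2 : Nat.card ↥(Set.Ioc k (k + n)) = n := by simp
  rw [h2] at this
  exact_mod_cast this

theorem bdd1 (A : Set ℤ) (n : ℕ) : BddAbove (Set.range fun k : ℤ => (Nat.card ↥(A ∩ Set.Ioc k (k + n)) : ℝ) / n) :=
  ⟨1, by rintro _ ⟨k, rfl⟩; exact card_nonneg_le A k n⟩

theorem ubd_exists (A : Set ℤ) (β : ℝ) (h : β < upperBanachDensity A) (n0 : ℕ) :
    ∃ n ≥ n0, ∃ k : ℤ, β < (Nat.card ↥(A ∩ Set.Ioc k (k + n)) : ℝ) / n := by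
  have h1 := Filter.frequently_lt_of_lt_limsup (f := Filter.atTop) ?_ h
  · obtain ⟨n, hn, h2⟩ := (Filter.frequently_atTop.1 h1) n0
    exact ⟨n, hn, exists_lt_of_lt_ciSup h2⟩
  · refine Filter.IsBoundedUnder.isCoboundedUnder_le ?_
    exact Filter.isBoundedUnder_of ⟨0, fun n => Real.iSup_nonneg fun k => by positivity⟩

theorem le_ubd (A : Set ℤ) (β : ℝ) (h : ∀ n : ℕ, 0 < n → ∃ k : ℤ, β ≤ (Nat.card ↥(A ∩ Set.Ioc k (k + n)) : ℝ) / n) :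
    β ≤ upperBanachDensity A := by
  unfold upperBanachDensity
  refine Filter.le_limsup_of_frequently_le (Filter.Eventually.frequently ?_) ?_
  · filter_upwards [Filter.eventually_gt_atTop 0] with n hn
    obtain ⟨k, hk⟩ := h n hn
    exact hk.trans (le_ciSup (bdd1 A n) k)
  · exact Filter.isBoundedUnder_of ⟨1, fun n => ciSup_le fun k => card_nonneg_le A k n⟩

open MeasureTheory in
theorem dens {d : ℕ} (α : Fin d → AddCircle (1:ℝ)) (hα : Dense (Set.range fun n : ℤ => n • α))
    (U : Set (Fin d → AddCircle (1:ℝ))) (hU : IsOpen U) (β : ℝ) (hβ : ENNReal.ofReal β ≤ volume U) :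
    β ≤ upperBanachDensity {n : ℤ | n • α ∈ U} := by
  classical
  apply le_ubd
  intro n hn
  have hprob : IsProbabilityMeasure (volume : Measure (Fin d → AddCircle (1:ℝ))) := by
    constructor
    rw [← Set.pi_univ Set.univ, volume_pi_pi]
    simp [AddCircle.measure_univ]
  let f : (Fin d → AddCircle (1:ℝ)) → ENNReal := fun x => ∑ i ∈ Finset.Ioc (0:ℤ) n, U.indicator 1 (x + i • α)
  have hf : ∫⁻ x, f x = n * volume U := by
    have hm : Measurable (U.indicator (1 : (Fin d → AddCircle (1:ℝ)) → ENNReal)) := measurable_one.indicator hU.measurableSet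
    simp only [f]
    rw [lintegral_finsetSum]
    · have : ∀ i : ℤ, ∫⁻ x : Fin d → AddCircle (1:ℝ), U.indicator 1 (x + i • α) = volume U := by
        intro i
        rw [lintegral_add_right_eq_self (fun x => U.indicator (1 : (Fin d → AddCircle (1:ℝ)) → ENNReal) x) (i • α), lintegral_indicator_one hU.measurableSet]
      simp [this]
    · intro i _
      exact hm.comp (measurable_add_const _)
  obtain ⟨x, hx⟩ := exists_lintegral_le (μ := (volume : Measure (Fin d → AddCircle (1:ℝ)))) (f := f)
    (by rw [hf]; exact ENNReal.mul_ne_top (by simp) (measure_ne_top _ _))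
  let F := (Finset.Ioc (0:ℤ) n).filter (fun i => x + i • α ∈ U)
  have hfx : f x = F.card := by
    simp only [f, F, Set.indicator_apply, Finset.card_filter]
    simp
  have hV : IsOpen (⋂ i ∈ F, (fun y => y + i • α) ⁻¹' U) :=
    isOpen_biInter_finset fun i _ => hU.preimage (continuous_add_const _)
  obtain ⟨_, hmV, m, rfl⟩ := hα.inter_open_nonempty _ hV ⟨x, by simp [F]⟩
  refine ⟨m, ?_⟩
  have hc : F.card ≤ Nat.card ↥({n : ℤ | n • α ∈ U} ∩ Set.Ioc m (m + n)) := by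
    rw [← Finset.card_map (addLeftEmbedding m), Nat.card_coe_set_eq, ← Set.ncard_coe_finset]
    refine Set.ncard_le_ncard ?_ ((Set.finite_Ioc _ _).subset Set.inter_subset_right)
    intro z hz
    simp only [Finset.coe_map, Set.mem_image, Finset.mem_coe, addLeftEmbedding_apply] at hz
    obtain ⟨i, hi, rfl⟩ := hz
    have h1 := Set.mem_iInter₂.1 hmV i hi
    simp only [F, Finset.mem_filter, Finset.mem_Ioc] at hi
    refine ⟨?_, ?_, ?_⟩
    · show (m + i) • α ∈ U
      rw [add_smul]; exact h1
    · omega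
    · omega
  rw [hf, hfx] at hx
  rw [le_div_iff₀ (by positivity)]
  refine le_trans ?_ (Nat.cast_le.2 hc)
  have h1 : ENNReal.ofReal (β * n) ≤ ENNReal.ofReal F.card := by
    rw [ENNReal.ofReal_mul' (by positivity), ENNReal.ofReal_natCast, ENNReal.ofReal_natCast, mul_comm]
    exact le_trans (by gcongr) hx
  exact (ENNReal.ofReal_le_ofReal_iff (by positivity)).1 h1

theorem periodize (δ : ℝ) (hδ : 0 < δ) (S : Set ℤ) (hS : Nonrecurrent δ S) (M : ℕ)
    (hM : ∀ s ∈ S, |s| ≤ M) :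
    ∃ N : ℕ, 0 < N ∧ ∃ B : Finset (ZMod N), δ * N < B.card ∧
      ∀ s ∈ S, ∀ a ∈ B, ∀ b ∈ B, b ≠ a + (s : ZMod N) := by
  classical
  obtain ⟨A, hA, hAS⟩ := hS
  obtain ⟨δ', h1, h2⟩ := exists_between hA
  obtain ⟨n0, hn0⟩ := exists_nat_gt (δ * M / (δ' - δ))
  obtain ⟨n, hn, p, hp⟩ := ubd_exists A δ' h2 (n0 + 1)
  have hnpos : (0:ℝ) < n := by
    have : 0 < n := by omega
    exact_mod_cast this
  have hfin : (A ∩ Set.Ioc p (p + n)).Finite := (Set.finite_Ioc _ _).subset Set.inter_subset_right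
  have hmem : ∀ z, z ∈ hfin.toFinset ↔ z ∈ A ∧ p < z ∧ z ≤ p + n := by
    intro z; simp [Set.mem_Ioc]
  refine ⟨n + M, by omega, hfin.toFinset.image (fun z : ℤ => (z : ZMod (n+M))), ?_, ?_⟩
  · rw [Finset.card_image_of_injOn, ← Set.ncard_eq_toFinset_card _ hfin, ← Nat.card_coe_set_eq]
    · rw [lt_div_iff₀ hnpos] at hp
      refine lt_trans ?_ hp
      rw [div_lt_iff₀ (by linarith)] at hn0
      have : (n0:ℝ) ≤ n := by
        have : n0 ≤ n := by omega
        exact_mod_cast this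
      push_cast
      nlinarith
    · intro x hx y hy hxy
      rw [Finset.mem_coe, hmem] at hx hy
      simp only at hxy
      rw [ZMod.intCast_eq_intCast_iff_dvd_sub] at hxy
      have := Int.eq_zero_of_abs_lt_dvd hxy (by rw [abs_lt]; push_cast; constructor <;> omega)
      omega
  · intro s hs a ha b hb hab
    rw [Finset.mem_image] at ha hb
    obtain ⟨x, hx, rfl⟩ := ha
    obtain ⟨y, hy, rfl⟩ := hb
    rw [hmem] at hx hy
    have hab' : ((y : ℤ) : ZMod (n+M)) = ((x + s : ℤ) : ZMod (n+M)) := by push_cast; exact hab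
    rw [ZMod.intCast_eq_intCast_iff_dvd_sub] at hab'
    have hs' := abs_le.1 (hM s hs)
    have := Int.eq_zero_of_abs_lt_dvd hab' (by rw [abs_lt]; push_cast; constructor <;> omega)
    have : s ∈ (A - A) ∩ S := ⟨Set.mem_sub.2 ⟨y, hy.1, x, hx.1, by omega⟩, hs⟩
    rw [hAS] at this
    exact this

noncomputable def cpt {N : ℕ} (c : ZMod N) : AddCircle (1:ℝ) := ((c.val / N : ℝ) : AddCircle (1:ℝ))

theorem cpt_close {N : ℕ} [NeZero N] (c c' : ZMod N) (s : ℤ)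
    (h : ‖cpt c' - cpt c - s • ((1 / N : ℝ) : AddCircle (1:ℝ))‖ < 1 / N) : c' = c + (s : ZMod N) := by
  have hN : (0:ℝ) < N := by exact_mod_cast Nat.pos_of_ne_zero (NeZero.ne N)
  unfold cpt at h
  rw [← AddCircle.coe_zsmul, ← AddCircle.coe_sub, ← AddCircle.coe_sub, AddCircle.norm_eq] at h
  simp only [inv_one, one_mul, mul_one] at h
  set z := round ((c'.val / N : ℝ) - c.val / N - s • (1 / N : ℝ))
  have e : (c'.val / N : ℝ) - c.val / N - s • (1 / N : ℝ) - z = ((c'.val - c.val - s - N * z : ℤ) : ℝ) / N := by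
    push_cast; rw [zsmul_eq_mul]; field_simp
  rw [e, abs_div, abs_of_pos hN, div_lt_div_iff_of_pos_right hN] at h
  have h2 : |((c'.val : ℤ) - c.val - s - N * z : ℤ)| < 1 := by exact_mod_cast h
  rw [Int.abs_lt_one_iff] at h2
  have h3 : (((c'.val : ℤ) - c.val - s - N * z : ℤ) : ZMod N) = 0 := by rw [h2]; simp
  push_cast at h3
  simp only [ZMod.natCast_val, ZMod.cast_id', id_eq, CharP.cast_eq_zero, zero_mul, sub_zero] at h3
  linear_combination h3

def UU {N d : ℕ} (G : Finset (Fin d → ZMod N)) (r : ℝ) : Set (Fin d → AddCircle (1:ℝ)) :=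
  ⋃ c ∈ G, Set.pi Set.univ (fun j => Metric.ball (cpt (c j)) r)

theorem UU_open {N d : ℕ} (G : Finset (Fin d → ZMod N)) (r : ℝ) : IsOpen (UU G r) :=
  isOpen_biUnion fun _ _ => isOpen_set_pi Set.finite_univ fun _ _ => Metric.isOpen_ball

open MeasureTheory in
theorem UU_vol {N d : ℕ} [NeZero N] (G : Finset (Fin d → ZMod N)) (r : ℝ) (hr : 0 ≤ r) (hr2 : 2 * r ≤ 1 / N) :
    ENNReal.ofReal (G.card * (2 * r)^d) ≤ volume (UU G r) := by
  have hN : (1:ℝ) ≤ N := by exact_mod_cast Nat.pos_of_ne_zero (NeZero.ne N)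
  have h1 : (1:ℝ)/N ≤ 1 := by rw [div_le_one (by linarith)]; exact hN
  unfold UU
  rw [measure_biUnion_finset]
  · have : ∀ c : Fin d → ZMod N, volume (Set.pi Set.univ (fun j => Metric.ball (cpt (c j)) r)) = ENNReal.ofReal ((2*r)^d) := by
      intro c
      rw [volume_pi_pi]
      have : ∀ y : AddCircle (1:ℝ), volume (Metric.ball y r) = ENNReal.ofReal (2*r) := by
        intro y
        rw [← measure_congr (AddCircle.closedBall_ae_eq_ball (x := y) (ε := r)), AddCircle.volume_closedBall]
        rw [min_eq_right (by linarith)]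
      simp only [this]
      rw [ENNReal.ofReal_pow (by positivity)]
      simp
    simp only [this]
    rw [ENNReal.ofReal_mul (by positivity)]
    simp
  · intro c _ c' _ hne
    refine Set.disjoint_left.2 fun y hy hy' => hne ?_
    ext j
    rw [Set.mem_univ_pi] at hy hy'
    have a1 := hy j
    have a2 := hy' j
    rw [Metric.mem_ball] at a1 a2
    have := cpt_close (c' j) (c j) 0 ?_
    · simpa using this
    · rw [zero_smul, sub_zero, ← dist_eq_norm]
      have := dist_triangle_left (cpt (c j)) (cpt (c' j)) (y j)
      linarith
  · intro c _
    exact (isOpen_set_pi Set.finite_univ fun _ _ => Metric.isOpen_ball).measurableSet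

theorem exists_eta (δ g : ℝ) (N d : ℕ) (hN : 0 < N) (h : δ * (N:ℝ)^d < g) :
    ∃ η : ℝ, 0 < η ∧ 2 * η < 1 / N ∧ δ < g * (1 / N - 2 * η)^d := by
  have hNr : (0:ℝ) < N := by exact_mod_cast hN
  have hc : Continuous fun η : ℝ => g * (1 / N - 2 * η)^d := by fun_prop
  have h1 : ∀ᶠ η in nhds (0:ℝ), δ < g * (1 / N - 2 * η)^d := by
    refine hc.continuousAt.eventually (lt_mem_nhds ?_)
    simp only [mul_zero, sub_zero, one_div, inv_pow]
    rw [← div_eq_mul_inv, lt_div_iff₀ (by positivity)]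
    exact h
  have h2 : ∀ᶠ η : ℝ in nhds (0:ℝ), 2 * η < 1 / (N:ℝ) := by
    have : Continuous fun η : ℝ => 2 * η := by fun_prop
    refine this.continuousAt.eventually (gt_mem_nhds ?_)
    simp only [mul_zero]
    positivity
  have h3 : ∀ᶠ η in nhdsWithin (0:ℝ) (Set.Ioi 0), 0 < η := eventually_mem_nhdsWithin
  obtain ⟨η, hη⟩ := (h3.and ((h2.and h1).filter_mono nhdsWithin_le_nhds)).exists
  exact ⟨η, hη.1, hη.2.1, hη.2.2⟩

theorem stmt10 (δ : ℝ) (hδ : 0 < δ) (k : ℕ) (S : Set ℤ) (hSfin : S.Finite)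
    (hS : Nonrecurrent δ S) :
    ∃ η : ℝ, 0 < η ∧ ∃ d : ℕ, k < d ∧ ∃ α : Fin d → AddCircle (1 : ℝ),
      Dense (Set.range fun n : ℤ => n • α) ∧
        Nonrecurrent δ (S + bohrHamming α k η) := by
  obtain ⟨M, hM⟩ : ∃ M : ℕ, ∀ s ∈ S, |s| ≤ M := by
    obtain ⟨M, hM⟩ := (hSfin.image (fun s : ℤ => s.natAbs)).bddAbove
    refine ⟨M, fun s hs => ?_⟩
    have : s.natAbs ≤ M := hM ⟨s, hs, rfl⟩
    rw [Int.abs_eq_natAbs]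
    exact_mod_cast this
  obtain ⟨N, hN, B, hB, hBS⟩ := periodize δ hδ S hS M hM
  haveI : NeZero N := ⟨hN.ne'⟩
  obtain ⟨d, hkd, hd⟩ := GA_card B k δ hδ hB
  obtain ⟨η, hη, hη2, hη3⟩ := exists_eta δ _ N d hN hd
  obtain ⟨α, hα, hαc⟩ := exists_indep d (fun _ => ((1 / N : ℝ) : AddCircle (1:ℝ))) (η / (M + 1)) (by positivity)
  refine ⟨η, hη, d, hkd, α, hα, {n : ℤ | n • α ∈ UU (GA B k d) ((1 / N - 2 * η) / 2)}, ?_, ?_⟩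
  · refine lt_of_lt_of_le hη3 (dens α hα _ (UU_open _ _) _ ?_)
    have := UU_vol (GA B k d) ((1 / N - 2 * η) / 2) (by linarith) (by linarith)
    rwa [mul_div_cancel₀ _ (two_ne_zero)] at this
  · rw [Set.eq_empty_iff_forall_notMem]
    rintro z ⟨hz1, hz2⟩
    obtain ⟨n, hn, m, hm, rfl⟩ := Set.mem_sub.1 hz1
    obtain ⟨s, hs, b, hb, hsb⟩ := Set.mem_add.1 hz2
    simp only [Set.mem_setOf_eq, UU, Set.mem_iUnion, Set.mem_univ_pi, Metric.mem_ball] at hn hm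
    obtain ⟨y, hy, hyb⟩ := hn
    obtain ⟨x, hx, hxb⟩ := hm
    rcases le_or_gt (Finset.univ.filter (fun j => y j ≠ x j + (s : ZMod N))).card k with hk | hk
    · obtain ⟨a, ha, a', ha', h⟩ := GA_diff B k d (s : ZMod N) x y hx hy hk
      exact hBS s hs a ha a' ha' h
    · refine absurd (le_trans ?_ hb) (not_le.2 hk)
      rw [← Set.ncard_coe_finset]
      refine Set.ncard_le_ncard ?_ (Set.toFinite _)
      intro j hj
      simp only [Finset.coe_filter, Finset.mem_univ, true_and, Set.mem_setOf_eq] at hj ⊢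
      by_contra! hlt
      apply hj
      apply cpt_close
      have e1 := hyb j
      have e2 := hxb j
      rw [dist_comm, dist_eq_norm] at e1
      rw [dist_eq_norm] at e2
      have e3 : ‖s • (α j - ((1 / N : ℝ) : AddCircle (1:ℝ)))‖ < η := by
        have h1 := norm_zsmul_le (n := s) (a := α j - ((1 / N : ℝ) : AddCircle (1:ℝ)))
        refine h1.trans_lt ?_
        have h2 : ‖s‖ ≤ M := by
          rw [Int.norm_eq_abs]; exact_mod_cast hM s hs
        have h3 := hαc j
        calc ‖s‖ * ‖α j - ((1 / N : ℝ) : AddCircle (1:ℝ))‖ ≤ M * (η / (M+1)) := by gcongr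
          _ < η := by
            rw [mul_div_assoc', div_lt_iff₀ (by positivity)]
            nlinarith
      have hn : n = m + s + b := by omega
      have e : cpt (y j) - cpt (x j) - s • ((1 / N : ℝ) : AddCircle (1:ℝ)) =
          (cpt (y j) - (n • α) j) + ((m • α) j - cpt (x j)) + s • (α j - ((1 / N : ℝ) : AddCircle (1:ℝ))) + (b • α) j := by
        rw [hn]
        simp only [Pi.smul_apply, add_smul, smul_sub]
        abel
      rw [e]
      have t1 := norm_add_le ((cpt (y j) - (n • α) j) + ((m • α) j - cpt (x j)) + s • (α j - ((1 / N : ℝ) : AddCircle (1:ℝ)))) ((b • α) j)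
      have t2 := norm_add_le ((cpt (y j) - (n • α) j) + ((m • α) j - cpt (x j))) (s • (α j - ((1 / N : ℝ) : AddCircle (1:ℝ))))
      have t3 := norm_add_le (cpt (y j) - (n • α) j) ((m • α) j - cpt (x j))
      linarith
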